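/- Let φ : ℂⁿ → ℝ be a C² plurisubharmonic function with cω ≤ i∂∂̄φ ≤ Cω for some constants 0 < c ≤ C, let ε > 0, and let 1 ≤ p ≤ ∞. If Σ ⊂ ℂⁿ is a uniformly separated sequence that is a sampling sequence for BF^∞_{φ+ε|z|²}(ℂⁿ), then Σ is a sampling sequence for BF^p_φ(ℂⁿ). -/

import Mathlib

open MeasureTheory Metric Set
open scoped ENNReal NNReal Topology

noncomputable section

/-- `ℂⁿ` with the Euclidean (Hermitian) norm. -/
abbrev En (n : ℕ) : Type := EuclideanSpace ℂ (Fin n)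

instance (n : ℕ) : MeasurableSpace (En n) := borel _
instance (n : ℕ) : BorelSpace (En n) := ⟨rfl⟩

/-- Lebesgue measure on `ℂⁿ ≅ ℝ^{2n}`, realized as `2n`-dimensional Hausdorff measure. -/
def vol (n : ℕ) : Measure (En n) := μH[(2 * n : ℝ)]

/-- The surface measure `dσ` on a hypersurface `W` induced by `ω^{n-1}`:
a constant multiple of `(2n-2)`-dimensional Hausdorff measure restricted to `W`. -/
def surf (n : ℕ) (W : Set (En n)) : Measure (En n) :=
  ((2 : ℝ≥0∞) ^ (n - 1) * (Nat.factorial (n - 1) : ℝ≥0∞)) •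
    (μH[(2 * n - 2 : ℝ)] : Measure (En n)).restrict W

open Classical in
/-- The weighted `L^p`-"norm" (to the `p`-th power for `p < ∞`) of `F` over the set `S`
with respect to the measure `μ` and the weight `φ`; for `p = ∞` it is the weighted sup. -/
def wNorm {n : ℕ} (p : ℝ≥0∞) (φ : En n → ℝ) (μ : Measure (En n)) (S : Set (En n))
    (F : En n → ℂ) : ℝ≥0∞ :=
  if p = ⊤ then ⨆ z ∈ S, ENNReal.ofReal (‖F z‖ * Real.exp (-φ z))
  else ∫⁻ z in S, ENNReal.ofReal (‖F z‖ ^ p.toReal * Real.exp (-(p.toReal * φ z))) ∂μ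

/-- Real Hessian of `φ` at `z` in the directions `u`, `v`. -/
def hess {n : ℕ} (φ : En n → ℝ) (z u v : En n) : ℝ := fderiv ℝ (fderiv ℝ φ) z u v

/-- The Levi form `i∂∂̄φ(z)(v,v̄) = Σ φ_{j k̄}(z) v_j v̄_k`, expressed through the
real Hessian.  For `φ = ‖z‖²` it equals `‖v‖²`, i.e. `ω = i∂∂̄‖z‖²` corresponds to
`levi = ‖v‖²`. -/
def levi {n : ℕ} (φ : En n → ℝ) (z v : En n) : ℝ :=
  (hess φ z v v + hess φ z (Complex.I • v) (Complex.I • v)) / 4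

/-- `W` is uniformly flat with tubular radius `ε₀`: the neighborhood
`N_{ε₀}(W)` is a tubular neighborhood, i.e. every point of it has a unique nearest
point on `W` and the (smooth) nearest-point projection `pr` is well defined there. -/
def UniformlyFlatWith {n : ℕ} (ε₀ : ℝ) (W : Set (En n)) : Prop :=
  0 < ε₀ ∧ ∃ pr : En n → En n,
    ContDiffOn ℝ (⊤ : ℕ∞) pr {z | Metric.infDist z W < ε₀} ∧
    ∀ z : En n, Metric.infDist z W < ε₀ →
      pr z ∈ W ∧ dist z (pr z) = Metric.infDist z W ∧
        ∀ w ∈ W, dist z w = Metric.infDist z W → w = pr z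

/-- `W` is uniformly flat. -/
def UniformlyFlat {n : ℕ} (W : Set (En n)) : Prop := ∃ ε₀, UniformlyFlatWith ε₀ W

/-- `f` is holomorphic on the complex submanifold `W`: near every point of `W` it is
the restriction of some holomorphic function of the ambient space. -/
def HolOn {n : ℕ} (W : Set (En n)) (f : En n → ℂ) : Prop :=
  ∀ w ∈ W, ∃ U ∈ 𝓝 w, ∃ g : En n → ℂ, DifferentiableOn ℂ g U ∧ Set.EqOn f g (U ∩ W)

/-- The average `φ_r` of `φ` over the ball `B(z,r)`. -/
def avgBall {n : ℕ} (φ : En n → ℝ) (r : ℝ) (z : En n) : ℝ :=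
  ((vol n) (Metric.ball z r)).toReal⁻¹ * ∫ x in Metric.ball z r, φ x ∂(vol n)

/-- The averaged current of integration `Υ_W(z,r)(v,v̄)`: by Lelong–Poincaré,
`Υ_W(z,r)(v,v) = (π / vol B(z,r)) ∫_{W ∩ B(z,r)} |⟨v, n_w⟩|² dσ(w)`, where the unit
normal pairing is `|⟨v, n_w⟩| = ‖dT_w(v)‖ / ‖dT_w‖` for a defining function `T` of `W`. -/
def Upsilon {n : ℕ} (T : En n → ℂ) (W : Set (En n)) (r : ℝ) (z v : En n) : ℝ :=
  (Real.pi / ((vol n) (Metric.ball z r)).toReal) *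
    ∫ w in Metric.ball z r, (‖fderiv ℂ T w v‖ / ‖fderiv ℂ T w‖) ^ 2 ∂(surf n W)

/-- A set of points of `ℂⁿ` is uniformly separated if distinct points are at least a
fixed positive distance apart. -/
def UnifSep {n : ℕ} (S : Set (En n)) : Prop :=
  ∃ δ > (0 : ℝ), ∀ x ∈ S, ∀ y ∈ S, x ≠ y → δ ≤ dist x y

open Classical in
/-- The weighted `ℓ^p`-"norm" (to the `p`-th power for `p < ∞`) of the restriction of
`F` to the points of `S`; for `p = ∞` the weighted sup over `S`. -/
def seqNorm {n : ℕ} (p : ℝ≥0∞) (ψ : En n → ℝ) (S : Set (En n)) (F : En n → ℂ) : ℝ≥0∞ :=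
  if p = ⊤ then ⨆ σ ∈ S, ENNReal.ofReal (‖F σ‖ * Real.exp (-ψ σ))
  else ∑' σ : S, ENNReal.ofReal (‖F (σ : En n)‖ ^ p.toReal *
    Real.exp (-(p.toReal * ψ (σ : En n))))

/-- `S` is a sampling sequence for `BF^p_ψ(ℂⁿ)`: for `p < ∞`,
`M⁻¹ ∫ |F|^p e^{-pψ} ≤ Σ_{σ∈S} |F(σ)|^p e^{-pψ(σ)} ≤ M ∫ |F|^p e^{-pψ}`; for `p = ∞`,
`sup_{ℂⁿ} |F| e^{-ψ} ≤ M sup_S |F| e^{-ψ}`. -/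
def IsSamplingSeq {n : ℕ} (p : ℝ≥0∞) (ψ : En n → ℝ) (S : Set (En n)) : Prop :=
  ∃ M > (0 : ℝ), ∀ F : En n → ℂ, Differentiable ℂ F →
    wNorm p ψ (vol n) Set.univ F < ⊤ →
    wNorm p ψ (vol n) Set.univ F ≤ ENNReal.ofReal M * seqNorm p ψ S F ∧
    (p ≠ ⊤ → seqNorm p ψ S F ≤ ENNReal.ofReal M * wNorm p ψ (vol n) Set.univ F)

/-- Differentiation under the integral sign over a compact interval, for a jointly continuous
derivative. -/
lemma hasDerivAt_intervalIntegral_of_continuous {P P' : ℝ → ℝ → ℝ} {a b : ℝ}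
    (hP : ∀ t, Continuous (P t)) (hP' : Continuous (Function.uncurry P'))
    (hd : ∀ t θ, HasDerivAt (fun s => P s θ) (P' t θ) t) (t : ℝ) :
    HasDerivAt (fun s => ∫ θ in a..b, P s θ) (∫ θ in a..b, P' t θ) t := by
  obtain ⟨B, hB⟩ := ((isCompact_closedBall t 1).prod
    (isCompact_uIcc (a := a) (b := b))).exists_bound_of_continuousOn hP'.continuousOn
  refine (intervalIntegral.hasDerivAt_integral_of_dominated_loc_of_deriv_le (bound := fun _ => B)
    (s := closedBall t 1) (closedBall_mem_nhds t one_pos)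
    (.of_forall fun s => (hP s).aestronglyMeasurable) ((hP t).intervalIntegrable _ _)
    (hP'.uncurry_left t).aestronglyMeasurable
    (.of_forall fun θ hθ s hs => hB (s, θ) ⟨hs, uIoc_subset_uIcc hθ⟩)
    intervalIntegrable_const (.of_forall fun θ _ s _ => hd s θ)).2

/-- The mean of a `C²` function over the circle `z + e^{iθ} x` exceeds its value at the center
by at most `C ‖x‖²` when its Levi form is at most `C`. -/
lemma integral_circle_le {n : ℕ} {φ : En n → ℝ} (hφ : ContDiff ℝ 2 φ) {C : ℝ}
    (hu : ∀ z v : En n, levi φ z v ≤ C * ‖v‖ ^ 2) (z x : En n) :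
    ∫ θ in (0 : ℝ)..2 * Real.pi, φ (z + Complex.exp (θ * Complex.I) • x) ≤
      2 * Real.pi * (φ z + C * ‖x‖ ^ 2) := by
  set e : ℝ → En n := fun θ => Complex.exp (θ * Complex.I) • x with he
  have hec : Continuous e := by fun_prop
  have hed : ∀ θ, HasDerivAt e (Complex.I • e θ) θ := fun θ => by
    have h1 : HasDerivAt (fun θ : ℝ => Complex.exp (θ * Complex.I))
        (Complex.exp (θ * Complex.I) * (1 * Complex.I)) θ :=
      ((Complex.ofRealCLM.hasDerivAt (x := θ)).mul_const Complex.I).cexp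
    have h2 := h1.smul_const x
    rw [one_mul, mul_comm, mul_smul] at h2
    exact h2
  have hen : ∀ θ, ‖e θ‖ = ‖x‖ := fun θ => by
    simp [he, norm_smul, Complex.norm_exp_ofReal_mul_I]
  have hφ1 : Differentiable ℝ φ := hφ.differentiable (by norm_num)
  have hD : ContDiff ℝ 1 (fderiv ℝ φ) := hφ.fderiv_right (by norm_num)
  have hD1 : Differentiable ℝ (fderiv ℝ φ) := hD.differentiable (by norm_num)
  have hDc : Continuous (fderiv ℝ φ) := hD.continuous
  have hHc : Continuous (fderiv ℝ (fderiv ℝ φ)) := hD.continuous_fderiv (by norm_num)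
  have hp : ∀ t θ : ℝ, HasDerivAt (fun s : ℝ => z + s • e θ) (e θ) t := fun t θ => by
    simpa using ((hasDerivAt_id t).smul_const (e θ)).const_add z
  set P' : ℝ → ℝ → ℝ := fun t θ => fderiv ℝ φ (z + t • e θ) (e θ) with hP'
  set P'' : ℝ → ℝ → ℝ := fun t θ => hess φ (z + t • e θ) (e θ) (e θ) with hP''
  set Q : ℝ → ℝ → ℝ :=
    fun t θ => hess φ (z + t • e θ) (Complex.I • e θ) (Complex.I • e θ) with hQ
  have hcP' : Continuous (Function.uncurry P') := by
    simp only [hP', Function.uncurry_def]; fun_prop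
  have hcP'' : Continuous (Function.uncurry P'') := by
    simp only [hP'', Function.uncurry_def, hess]; fun_prop
  have hcQ : Continuous (Function.uncurry Q) := by
    simp only [hQ, Function.uncurry_def, hess]; fun_prop
  have d0 : ∀ t, HasDerivAt (fun s => ∫ θ in (0 : ℝ)..2 * Real.pi, φ (z + s • e θ))
      (∫ θ in (0 : ℝ)..2 * Real.pi, P' t θ) t :=
    hasDerivAt_intervalIntegral_of_continuous (fun t => hφ.continuous.comp (by fun_prop)) hcP'
      fun t θ => (hφ1 _).hasFDerivAt.comp_hasDerivAt t (hp t θ)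
  have d1 : ∀ t, HasDerivAt (fun s => ∫ θ in (0 : ℝ)..2 * Real.pi, P' s θ)
      (∫ θ in (0 : ℝ)..2 * Real.pi, P'' t θ) t :=
    hasDerivAt_intervalIntegral_of_continuous (fun t => hcP'.uncurry_left t) hcP''
      fun t θ => by
        have := ((hD1 _).hasFDerivAt.comp_hasDerivAt t (hp t θ)).clm_apply
          (hasDerivAt_const t (e θ))
        refine this.congr_deriv ?_
        simp [hP'', hess]
  have hang : ∀ t, ∫ θ in (0 : ℝ)..2 * Real.pi, P' t θ =
      t * ∫ θ in (0 : ℝ)..2 * Real.pi, Q t θ := fun t => by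
    have hd : ∀ θ, HasDerivAt (fun θ => fderiv ℝ φ (z + t • e θ) (Complex.I • e θ))
        (t * Q t θ - P' t θ) θ := fun θ => by
      have h1 : HasDerivAt (fun θ => z + t • e θ) (t • Complex.I • e θ) θ :=
        ((hed θ).const_smul t).const_add z
      have h2 : HasDerivAt (fun θ => Complex.I • e θ) (Complex.I • Complex.I • e θ) θ :=
        (hed θ).const_smul Complex.I
      have h3 := ((hD1 _).hasFDerivAt.comp_hasDerivAt θ h1).clm_apply h2
      refine h3.congr_deriv ?_
      simp [hQ, hP', hess, smul_smul, sub_eq_add_neg]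
    have hi := intervalIntegral.integral_eq_sub_of_hasDerivAt (a := 0) (b := 2 * Real.pi)
      (fun θ _ => hd θ)
      (((continuous_const.mul (hcQ.uncurry_left t)).sub (hcP'.uncurry_left t)).intervalIntegrable
        _ _)
    have hper : e (2 * Real.pi) = e 0 := by simp [he, Complex.exp_two_pi_mul_I]
    rw [intervalIntegral.integral_sub (f := fun y => t * Q t y)
      ((continuous_const.mul (hcQ.uncurry_left t)).intervalIntegrable _ _)
      ((hcP'.uncurry_left t).intervalIntegrable _ _), intervalIntegral.integral_const_mul,
      hper, sub_self] at hi
    linarith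
  set K : ℝ := 8 * Real.pi * (C * ‖x‖ ^ 2) with hK
  have hlap : ∀ t, (∫ θ in (0 : ℝ)..2 * Real.pi, P'' t θ) +
      ∫ θ in (0 : ℝ)..2 * Real.pi, Q t θ ≤ K := fun t => by
    have i1 := (hcP''.uncurry_left t).intervalIntegrable (μ := volume) 0 (2 * Real.pi)
    have i2 := (hcQ.uncurry_left t).intervalIntegrable (μ := volume) 0 (2 * Real.pi)
    rw [← intervalIntegral.integral_add i1 i2]
    refine (intervalIntegral.integral_mono_on (g := fun _ => 4 * (C * ‖x‖ ^ 2)) (by positivity)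
      (i1.add i2) intervalIntegrable_const fun θ _ => ?_).trans ?_
    · have := hu (z + t • e θ) (e θ)
      rw [levi, hen] at this
      simp only [hP'', hQ]
      linarith
    · rw [intervalIntegral.integral_const, hK, smul_eq_mul]
      apply le_of_eq; ring
  set h1 : ℝ → ℝ := fun t => ∫ θ in (0 : ℝ)..2 * Real.pi, P' t θ with hh1
  have hu1 : AntitoneOn (fun t => t * h1 t - K * t ^ 2 / 2) (Ici 0) := by
    have hd : ∀ t, HasDerivAt (fun t => t * h1 t - K * t ^ 2 / 2)
        (1 * h1 t + t * (∫ θ in (0 : ℝ)..2 * Real.pi, P'' t θ) - K * t) t := fun t => by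
      refine (((hasDerivAt_id t).mul (d1 t)).sub
        ((((hasDerivAt_id t).pow 2).const_mul K).div_const 2)).congr_deriv ?_
      simp; ring
    refine antitoneOn_of_hasDerivWithinAt_nonpos (convex_Ici 0)
      (fun t _ => (hd t).continuousAt.continuousWithinAt)
      (fun t _ => (hd t).hasDerivWithinAt) fun t ht => ?_
    rw [interior_Ici] at ht
    have := mul_le_mul_of_nonneg_left (hlap t) (le_of_lt ht)
    have h2 := hang t
    change h1 t = _ at h2
    nlinarith
  have hh0 : ∀ t, 0 < t → h1 t ≤ K * t / 2 := fun t ht => by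
    have := hu1 self_mem_Ici ht.le ht.le
    simp only [zero_mul] at this
    have h3 : t * h1 t ≤ t * (K * t / 2) := by nlinarith
    exact le_of_mul_le_mul_left h3 ht
  have hu0 : AntitoneOn (fun t => (∫ θ in (0 : ℝ)..2 * Real.pi, φ (z + t • e θ)) - K * t ^ 2 / 4)
      (Ici 0) := by
    have hd : ∀ t, HasDerivAt
        (fun t => (∫ θ in (0 : ℝ)..2 * Real.pi, φ (z + t • e θ)) - K * t ^ 2 / 4)
        (h1 t - K * t / 2) t := fun t => by
      refine ((d0 t).sub ((((hasDerivAt_id t).pow 2).const_mul K).div_const 4)).congr_deriv ?_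
      simp [hh1]; ring
    refine antitoneOn_of_hasDerivWithinAt_nonpos (convex_Ici 0)
      (fun t _ => (hd t).continuousAt.continuousWithinAt)
      (fun t _ => (hd t).hasDerivWithinAt) fun t ht => ?_
    rw [interior_Ici] at ht
    linarith [hh0 t ht]
  have := hu0 self_mem_Ici (mem_Ici.2 zero_le_one) zero_le_one
  simp only [one_smul, zero_smul, add_zero, intervalIntegral.integral_const, smul_eq_mul] at this
  rw [hK] at this
  linarith

/-- The logarithm of the modulus of a holomorphic function has the sub-mean value property. -/
lemma log_norm_le_circleAverage {f : ℂ → ℂ} (hf : Differentiable ℂ f) (h0 : f 0 ≠ 0) :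
    Real.log ‖f 0‖ ≤ Real.circleAverage (fun ζ => Real.log ‖f ζ‖) 0 1 := by
  have hA : AnalyticOnNhd ℂ f (closedBall 0 |1|) := fun ζ _ => hf.analyticAt ζ
  rw [hA.circleAverage_log_norm one_ne_zero h0]
  refine le_add_of_nonneg_left (finsum_nonneg fun u => ?_)
  by_cases hu : u ∈ closedBall (0 : ℂ) |1|
  · refine mul_nonneg (mod_cast MeromorphicOn.AnalyticOnNhd.divisor_nonneg hA u) ?_
    rcases eq_or_ne u 0 with rfl | hu0
    · simp
    · refine Real.log_nonneg ?_
      have : ‖u‖ ≤ 1 := by simpa using hu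
      simpa using (one_le_inv₀ (norm_pos_iff.2 hu0)).2 this
  · rw [Function.locallyFinsuppWithin.apply_eq_zero_of_notMem _ hu]
    simp

/-- Sub-mean value property of `|F|^p e^{-pφ}` over the circle `z + e^{iθ} x`, up to the factor
`e^{pC‖x‖²}`. -/
lemma weighted_le_integral_circle {n : ℕ} {φ : En n → ℝ} (hφ : ContDiff ℝ 2 φ) {C : ℝ}
    (hu : ∀ z v : En n, levi φ z v ≤ C * ‖v‖ ^ 2) {F : En n → ℂ} (hF : Differentiable ℂ F)
    {p : ℝ} (hp : 0 < p) (z x : En n) :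
    ‖F z‖ ^ p * Real.exp (-(p * φ z)) * Real.exp (-(p * (C * ‖x‖ ^ 2))) * (2 * Real.pi) ≤
      ∫ θ in (0 : ℝ)..2 * Real.pi, ‖F (z + Complex.exp (θ * Complex.I) • x)‖ ^ p *
        Real.exp (-(p * φ (z + Complex.exp (θ * Complex.I) • x))) := by
  have hpi : (0 : ℝ) < 2 * Real.pi := by positivity
  rcases eq_or_ne (F z) 0 with h0 | h0
  · rw [h0, norm_zero, Real.zero_rpow hp.ne', zero_mul, zero_mul, zero_mul]
    exact intervalIntegral.integral_nonneg hpi.le fun θ _ => by positivity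
  set f : ℂ → ℂ := fun ζ => F (z + ζ • x) with hf
  have hfd : Differentiable ℂ f := hF.comp (by fun_prop)
  have hf0 : f 0 ≠ 0 := by simpa [hf] using h0
  have hfA : AnalyticOnNhd ℂ f univ := fun ζ _ => hfd.analyticAt ζ
  have hcm : ∀ θ : ℝ, circleMap 0 1 θ = Complex.exp (θ * Complex.I) := fun θ => by
    simp [circleMap]
  set y : ℝ → En n := fun θ => z + Complex.exp (θ * Complex.I) • x with hy
  have hyc : Continuous y := by fun_prop
  have hφi : IntervalIntegrable (fun θ => φ (y θ)) volume 0 (2 * Real.pi) :=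
    (hφ.continuous.comp hyc).intervalIntegrable _ _
  have hli : IntervalIntegrable (fun θ => Real.log ‖F (y θ)‖) volume 0 (2 * Real.pi) := by
    have := MeromorphicOn.circleIntegrable_log_norm (f := f) (c := 0) (R := 1)
      (fun ζ _ => (hfd.analyticAt ζ).meromorphicAt)
    simpa only [CircleIntegrable, hcm] using this
  have hlog := log_norm_le_circleAverage hfd hf0
  rw [Real.circleAverage_def, smul_eq_mul, ← div_eq_inv_mul, le_div_iff₀ hpi] at hlog
  simp only [hcm] at hlog
  have hne : ∀ᵐ θ ∂volume.restrict (Ioc 0 (2 * Real.pi)), F (y θ) ≠ 0 := by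
    have h1 : ∀ᶠ ζ in Filter.codiscreteWithin univ, f ζ ≠ 0 :=
      (hfA.eqOn_zero_or_eventually_ne_zero_of_preconnected isPreconnected_univ).resolve_left
        fun h => hf0 (h (mem_univ _))
    have h2 := circleMap_preimage_codiscrete (c := 0) (R := 1) one_ne_zero
      (Filter.codiscreteWithin_mono (subset_univ _) h1)
    have h3 := ae_restrict_le_codiscreteWithin (μ := volume)
      (measurableSet_Ioc (a := (0 : ℝ)) (b := 2 * Real.pi))
      (Filter.codiscreteWithin_mono (subset_univ _) h2)
    filter_upwards [h3] with θ hθ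
    simpa [hf, hcm] using hθ
  set G : ℝ → ℝ := fun θ => ‖F (y θ)‖ ^ p * Real.exp (-(p * φ (y θ))) with hG
  have hGc : Continuous G :=
    ((hF.continuous.comp hyc).norm.rpow_const fun _ => Or.inr hp.le).mul
      (Real.continuous_exp.comp (continuous_const.mul (hφ.continuous.comp hyc)).neg)
  set u : ℝ → ℝ := fun θ => p * (Real.log ‖F (y θ)‖ - φ (y θ)) with hu'
  have hexp : ∀ w, F w ≠ 0 → Real.exp (p * (Real.log ‖F w‖ - φ w)) =
      ‖F w‖ ^ p * Real.exp (-(p * φ w)) := fun w hw => by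
    rw [Real.rpow_def_of_pos (norm_pos_iff.2 hw), ← Real.exp_add]
    ring_nf
  have hae : Real.exp ∘ u =ᵐ[volume.restrict (Ioc 0 (2 * Real.pi))] G := by
    filter_upwards [hne] with θ hθ using hexp _ hθ
  have hui : IntervalIntegrable u volume 0 (2 * Real.pi) := (hli.sub hφi).const_mul p
  have hGi := hGc.intervalIntegrable (μ := volume) 0 (2 * Real.pi)
  have hJ := convexOn_exp.map_set_average_le (μ := volume) (t := Ioc 0 (2 * Real.pi)) (f := u)
    Real.continuous_exp.continuousOn isClosed_univ (by simp [Real.pi_pos])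
    measure_Ioc_lt_top.ne
    (.of_forall fun _ => mem_univ _) ((intervalIntegrable_iff_integrableOn_Ioc_of_le hpi.le).1 hui)
    (((intervalIntegrable_iff_integrableOn_Ioc_of_le hpi.le).1 hGi).congr hae.symm)
  have hae' : (fun θ => Real.exp (u θ)) =ᵐ[volume.restrict (Ioc 0 (2 * Real.pi))] G := hae
  rw [setAverage_eq, setAverage_eq, integral_congr_ae hae',
    ← intervalIntegral.integral_of_le hpi.le, ← intervalIntegral.integral_of_le hpi.le,
    smul_eq_mul, smul_eq_mul, Real.volume_real_Ioc_of_le hpi.le, sub_zero,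
    ← div_eq_inv_mul, ← div_eq_inv_mul, le_div_iff₀ hpi] at hJ
  refine le_trans ?_ hJ
  rw [← hexp z h0, ← Real.exp_add]
  gcongr
  rw [le_div_iff₀ hpi, hu', intervalIntegral.integral_const_mul,
    intervalIntegral.integral_sub hli hφi]
  have hm := integral_circle_le hφ hu z x
  simp only [hf, zero_smul, add_zero] at hlog
  have := mul_le_mul_of_nonneg_left (sub_le_sub hlog hm) hp.le
  refine le_trans (le_of_eq ?_) this
  ring

instance vol_isAddHaarMeasure (n : ℕ) : (vol n).IsAddHaarMeasure := by
  have h : (Module.finrank ℝ (En n) : ℝ) = 2 * n := by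
    rw [finrank_real_of_complex, finrank_euclideanSpace_fin]; push_cast; ring
  rw [vol, ← h]
  infer_instance

/-- Sub-mean value property of `|F|^p e^{-pφ}` over balls. -/
lemma weighted_mul_vol_ball_le {n : ℕ} {φ : En n → ℝ} (hφ : ContDiff ℝ 2 φ) {C : ℝ}
    (hC : 0 ≤ C)
    (hu : ∀ z v : En n, levi φ z v ≤ C * ‖v‖ ^ 2) {F : En n → ℂ} (hF : Differentiable ℂ F)
    {p : ℝ} (hp : 0 < p) (r : ℝ) (z : En n) :
    ENNReal.ofReal (‖F z‖ ^ p * Real.exp (-(p * φ z))) *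
        (ENNReal.ofReal (Real.exp (-(p * (C * r ^ 2)))) * vol n (ball 0 r)) ≤
      ∫⁻ w in ball z r, ENNReal.ofReal (‖F w‖ ^ p * Real.exp (-(p * φ w))) ∂vol n := by
  set G : En n → ℝ := fun w => ‖F w‖ ^ p * Real.exp (-(p * φ w)) with hG
  have hG0 : ∀ w, 0 ≤ G w := fun w => by positivity
  have hGc : Continuous G :=
    (hF.continuous.norm.rpow_const fun _ => Or.inr hp.le).mul
      (Real.continuous_exp.comp (continuous_const.mul hφ.continuous).neg)
  set g : En n → ℝ≥0∞ := fun w => ENNReal.ofReal (G w) with hg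
  have hgc : Continuous g := ENNReal.continuous_ofReal.comp hGc
  have hpi : (0 : ℝ) < 2 * Real.pi := by positivity
  have hrot : ∀ θ : ℝ, ∫⁻ x in ball 0 r, g (z + Complex.exp (θ * Complex.I) • x) ∂vol n =
      ∫⁻ w in ball z r, g w ∂vol n := fun θ => by
    have hn : ‖Complex.exp (θ * Complex.I)‖ = 1 := Complex.norm_exp_ofReal_mul_I θ
    set a : ℂ := Complex.exp (θ * Complex.I) with ha
    have ha0 : a ≠ 0 := Complex.exp_ne_zero _
    let E : En n ≃ᵢ En n := ⟨(Homeomorph.smulOfNeZero a ha0).toEquiv.trans (Equiv.addLeft z), by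
      refine Isometry.of_dist_eq fun x y => ?_
      simp [dist_smul₀, hn]⟩
    have hE : MeasurePreserving E (vol n) (vol n) := E.measurePreserving_hausdorffMeasure _
    have hpre : E ⁻¹' ball z r = ball 0 r := by
      ext x
      have : E x = z + a • x := rfl
      rw [mem_preimage, this, mem_ball_iff_norm, add_sub_cancel_left, norm_smul, hn, one_mul,
        mem_ball_zero_iff]
    rw [← hpre]
    exact hE.setLIntegral_comp_preimage_emb E.toHomeomorph.measurableEmbedding g _
  have hcirc : ∀ x ∈ ball (0 : En n) r,
      g z * ENNReal.ofReal (Real.exp (-(p * (C * r ^ 2)))) * ENNReal.ofReal (2 * Real.pi) ≤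
      ∫⁻ θ in Ioc (0 : ℝ) (2 * Real.pi), g (z + Complex.exp (θ * Complex.I) • x) := by
    intro x hx
    have h1 := weighted_le_integral_circle hφ hu hF hp z x
    have hxr : ‖x‖ ≤ r := (mem_ball_zero_iff.1 hx).le
    have hc : Continuous fun θ : ℝ => G (z + Complex.exp (θ * Complex.I) • x) :=
      hGc.comp (by fun_prop)
    rw [intervalIntegral.integral_of_le hpi.le] at h1
    rw [← ofReal_integral_eq_lintegral_ofReal
      ((intervalIntegrable_iff_integrableOn_Ioc_of_le hpi.le).1 (hc.intervalIntegrable _ _))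
      (.of_forall fun θ => hG0 _), hg, ← ENNReal.ofReal_mul (hG0 _),
      ← ENNReal.ofReal_mul (by positivity)]
    refine ENNReal.ofReal_le_ofReal (le_trans ?_ h1)
    have := hG0 z
    simp only [hG] at this ⊢
    gcongr
  have hswap := lintegral_lintegral_swap (μ := (vol n).restrict (ball 0 r))
    (ν := volume.restrict (Ioc (0 : ℝ) (2 * Real.pi)))
    (f := fun x θ => g (z + Complex.exp (θ * Complex.I) • x))
    (hgc.comp (by fun_prop)).aemeasurable
  have hle := setLIntegral_mono' (μ := vol n) measurableSet_ball hcirc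
  rw [setLIntegral_const, hswap] at hle
  simp only [hrot, lintegral_const, Measure.restrict_apply_univ, Real.volume_Ioc, sub_zero] at hle
  have h0 : ENNReal.ofReal (2 * Real.pi) ≠ 0 := by simp [Real.pi_pos]
  refine (ENNReal.mul_le_mul_iff_left h0 ENNReal.ofReal_ne_top).1 (le_trans (le_of_eq ?_) hle)
  ring

/-- Gaussians are integrable on `ℂⁿ`. -/
lemma lintegral_gaussian_lt_top (n : ℕ) {b : ℝ} (hb : 0 < b) :
    ∫⁻ x : En n, ENNReal.ofReal (Real.exp (-(b * ‖x‖ ^ 2))) ∂vol n < ⊤ := by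
  set d := Module.finrank ℝ (En n) with hd
  set B : ℝ := (d + 1).factorial * Real.exp (1 + 1 / (4 * b)) with hB
  have hle : ∀ x : En n, Real.exp (-(b * ‖x‖ ^ 2)) ≤ B * (1 + ‖x‖) ^ (-((d + 1 : ℕ) : ℝ)) := by
    intro x
    set t := ‖x‖ with ht
    have ht0 : 0 ≤ t := norm_nonneg x
    rw [Real.rpow_neg (by positivity), Real.rpow_natCast, ← div_eq_mul_inv,
      le_div_iff₀ (by positivity)]
    have h1 : (1 + t) ^ (d + 1) ≤ (d + 1).factorial * Real.exp (1 + t) := by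
      have := Real.pow_div_factorial_le_exp (1 + t) (by positivity) (d + 1)
      rwa [div_le_iff₀' (by positivity)] at this
    calc Real.exp (-(b * t ^ 2)) * (1 + t) ^ (d + 1)
        ≤ Real.exp (-(b * t ^ 2)) * ((d + 1).factorial * Real.exp (1 + t)) := by gcongr
      _ = (d + 1).factorial * Real.exp (1 + (t - b * t ^ 2)) := by
          rw [mul_left_comm, ← Real.exp_add]; ring_nf
      _ ≤ B := by
          rw [hB]
          gcongr
          rw [le_div_iff₀ (by positivity)]
          nlinarith [sq_nonneg (2 * b * t - 1)]
  have hfin := finite_integral_one_add_norm (E := En n) (μ := vol n) (r := ((d + 1 : ℕ) : ℝ))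
    (by exact_mod_cast Nat.lt_succ_self d)
  calc ∫⁻ x : En n, ENNReal.ofReal (Real.exp (-(b * ‖x‖ ^ 2))) ∂vol n
      ≤ ∫⁻ x : En n, ENNReal.ofReal B *
          ENNReal.ofReal ((1 + ‖x‖) ^ (-((d + 1 : ℕ) : ℝ))) ∂vol n := by
        refine lintegral_mono fun x => ?_
        rw [← ENNReal.ofReal_mul (by positivity)]
        exact ENNReal.ofReal_le_ofReal (hle x)
    _ < ⊤ := by
        rw [lintegral_const_mul' _ _ ENNReal.ofReal_ne_top]
        exact ENNReal.mul_lt_top ENNReal.ofReal_lt_top hfin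

/-- Testing `∞`-sampling for the weight `φ + ε|z|²` on `F(z) e^{2ε⟨z,w⟩ - ε|w|²}` localizes the
sampling inequality for the weight `φ` near `w` by a Gaussian. -/
lemma le_iSup_gaussian_of_sampling {n : ℕ} {φ : En n → ℝ} {ε : ℝ} (hε : 0 < ε)
    {S : Set (En n)} {M : ℝ}
    (hM : ∀ F : En n → ℂ, Differentiable ℂ F →
      wNorm ⊤ (fun z => φ z + ε * ‖z‖ ^ 2) (vol n) univ F < ⊤ →
      wNorm ⊤ (fun z => φ z + ε * ‖z‖ ^ 2) (vol n) univ F ≤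
        ENNReal.ofReal M * seqNorm ⊤ (fun z => φ z + ε * ‖z‖ ^ 2) S F)
    {F : En n → ℂ} (hF : Differentiable ℂ F) {B : ℝ≥0∞} (hB : B < ⊤)
    (hFB : ∀ z, ENNReal.ofReal (‖F z‖ * Real.exp (-φ z)) ≤ B) (w : En n) :
    ENNReal.ofReal (‖F w‖ * Real.exp (-φ w)) ≤ ENNReal.ofReal M *
      ⨆ σ ∈ S, ENNReal.ofReal (‖F σ‖ * Real.exp (-φ σ) * Real.exp (-(ε * ‖w - σ‖ ^ 2))) := by
  set G : En n → ℂ := fun z =>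
    F z * Complex.exp (2 * ε * innerSL ℂ w z - ((ε * ‖w‖ ^ 2 : ℝ) : ℂ)) with hG
  have hGd : Differentiable ℂ G := hF.mul
    ((((innerSL ℂ w).differentiable.const_mul _).sub_const _).cexp)
  have hGn : ∀ z, ‖G z‖ * Real.exp (-(φ z + ε * ‖z‖ ^ 2)) =
      ‖F z‖ * Real.exp (-φ z) * Real.exp (-(ε * ‖w - z‖ ^ 2)) := fun z => by
    have h1 : (2 * ε * innerSL ℂ w z - ((ε * ‖w‖ ^ 2 : ℝ) : ℂ)).re =
        2 * ε * (inner ℂ w z).re - ε * ‖w‖ ^ 2 := by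
      rw [Complex.sub_re, Complex.ofReal_re, innerSL_apply_apply,
        show (2 * ε : ℂ) = ((2 * ε : ℝ) : ℂ) by push_cast; ring, Complex.re_ofReal_mul]
    have h2 := norm_sub_sq (𝕜 := ℂ) w z
    simp only [RCLike.re_to_complex] at h2
    rw [hG, norm_mul, Complex.norm_exp, h1, mul_assoc, mul_assoc ‖F z‖, ← Real.exp_add,
      ← Real.exp_add, h2]
    ring_nf
  have hfin : wNorm ⊤ (fun z => φ z + ε * ‖z‖ ^ 2) (vol n) univ G < ⊤ := by
    refine lt_of_le_of_lt ?_ hB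
    simp only [wNorm, if_true, hGn]
    refine iSup₂_le fun z _ => le_trans (ENNReal.ofReal_le_ofReal ?_) (hFB z)
    refine mul_le_of_le_one_right (by positivity) (Real.exp_le_one_iff.2 ?_)
    have : 0 ≤ ε * ‖w - z‖ ^ 2 := by positivity
    linarith
  have h := hM G hGd hfin
  simp only [wNorm, seqNorm, if_true, hGn] at h
  refine le_trans ?_ h
  refine le_trans (le_of_eq ?_) (le_iSup₂ (f := fun (z : En n) (_ : z ∈ univ) =>
    ENNReal.ofReal (‖F z‖ * Real.exp (-φ z) * Real.exp (-(ε * ‖w - z‖ ^ 2)))) w (mem_univ w))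
  simp

/-- **Lemma (from `∞`-sampling for a slightly larger weight to `p`-sampling).**  If
`cω ≤ i∂∂̄φ ≤ Cω`, `ε > 0`, `1 ≤ p ≤ ∞` and the uniformly separated set `Σ` is sampling
for `BF^∞_{φ+ε|z|²}(ℂⁿ)`, then `Σ` is sampling for `BF^p_φ(ℂⁿ)`. -/
theorem sampling_inheritance
    (n : ℕ) (φ : En n → ℝ) (hφ : ContDiff ℝ 2 φ)
    (c C : ℝ) (hc : 0 < c) (hcC : c ≤ C)
    (hl : ∀ z v : En n, c * ‖v‖ ^ 2 ≤ levi φ z v)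
    (hu : ∀ z v : En n, levi φ z v ≤ C * ‖v‖ ^ 2)
    (ε : ℝ) (hε : 0 < ε) (p : ℝ≥0∞) (hp : 1 ≤ p)
    (S : Set (En n)) (hsep : UnifSep S)
    (hsamp : IsSamplingSeq ⊤ (fun z => φ z + ε * ‖z‖ ^ 2) S) :
    IsSamplingSeq p φ S := by
  obtain ⟨M, hM0, hM⟩ := hsamp
  have hkey := fun (F : En n → ℂ) (hF : Differentiable ℂ F) (B : ℝ≥0∞) (hB : B < ⊤) =>
    le_iSup_gaussian_of_sampling (B := B) hε (fun F hF hfin => (hM F hF hfin).1) hF hB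
  by_cases hpt : p = ⊤
  · subst hpt
    refine ⟨M, hM0, fun F hF hfin => ⟨?_, fun h => absurd rfl h⟩⟩
    have hk := hkey F hF _ hfin fun z => by
      rw [wNorm, if_pos rfl]
      exact le_iSup₂ (f := fun (z : En n) (_ : z ∈ univ) =>
        ENNReal.ofReal (‖F z‖ * Real.exp (-φ z))) z (mem_univ z)
    simp only [wNorm, seqNorm, if_true]
    refine iSup₂_le fun w _ => (hk w).trans ?_
    refine mul_le_mul_right (iSup₂_mono fun σ hσ => ENNReal.ofReal_le_ofReal ?_) _
    refine mul_le_of_le_one_right (by positivity) (Real.exp_le_one_iff.2 ?_)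
    have : 0 ≤ ε * ‖w - σ‖ ^ 2 := by positivity
    linarith
  obtain ⟨δ, hδ, hS⟩ := hsep
  set q := p.toReal with hq
  have hq0 : 0 < q := ENNReal.toReal_pos (zero_lt_one.trans_le hp).ne' hpt
  have hdisj : Pairwise (Function.onFun Disjoint fun σ : S => ball (σ : En n) (δ / 2)) := by
    intro σ τ h
    refine ball_disjoint_ball ?_
    have := hS σ σ.2 τ τ.2 fun h' => h (Subtype.ext h')
    linarith
  have hcount : Countable S := hdisj.countable_of_isOpen_disjoint (fun _ => isOpen_ball)
    fun σ => nonempty_ball.2 (half_pos hδ)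
  set K : ℝ≥0∞ := ENNReal.ofReal (Real.exp (-(q * (C * (δ / 2) ^ 2)))) *
    vol n (ball 0 (δ / 2)) with hK
  have hK0 : K ≠ 0 := mul_ne_zero (by simp [Real.exp_pos])
    (measure_ball_pos _ _ (half_pos hδ)).ne'
  have hKt : K ≠ ⊤ := ENNReal.mul_ne_top ENNReal.ofReal_ne_top measure_ball_lt_top.ne
  set D : ℝ≥0∞ := ∫⁻ x : En n, ENNReal.ofReal (Real.exp (-(q * ε * ‖x‖ ^ 2))) ∂vol n with hD
  have hDt : D ≠ ⊤ := (lintegral_gaussian_lt_top n (mul_pos hq0 hε)).ne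
  have hKi : 0 < (K⁻¹).toReal :=
    ENNReal.toReal_pos (ENNReal.inv_ne_zero.2 hKt) (ENNReal.inv_ne_top.2 hK0)
  refine ⟨M ^ q * D.toReal + (K⁻¹).toReal, by positivity, fun F hF hfin => ?_⟩
  set g : En n → ℝ≥0∞ :=
    fun z => ENNReal.ofReal (‖F z‖ ^ q * Real.exp (-(q * φ z))) with hg
  have hmean : ∀ z, g z * K ≤ ∫⁻ w in ball z (δ / 2), g w ∂vol n :=
    weighted_mul_vol_ball_le hφ (hc.le.trans hcC) hu hF hq0 (δ / 2)
  have hpow : ∀ z, ENNReal.ofReal (‖F z‖ * Real.exp (-φ z)) ^ q = g z := fun z => by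
    rw [ENNReal.ofReal_rpow_of_nonneg (by positivity) hq0.le,
      Real.mul_rpow (by positivity) (by positivity), ← Real.exp_mul]
    simp only [hg]
    ring_nf
  simp only [wNorm, if_neg hpt, setLIntegral_univ, seqNorm] at hfin ⊢
  change ∫⁻ z, g z ∂vol n < ⊤ at hfin
  change ∫⁻ z, g z ∂vol n ≤ _ * ∑' σ : S, g σ ∧ (_ → ∑' σ : S, g σ ≤ _ * ∫⁻ z, g z ∂vol n)
  rw [ENNReal.ofReal_add (by positivity) (by positivity), ENNReal.ofReal_mul (by positivity),
    ENNReal.ofReal_toReal hDt, ENNReal.ofReal_toReal (ENNReal.inv_ne_top.2 hK0),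
    ← ENNReal.ofReal_rpow_of_nonneg hM0.le hq0.le]
  constructor
  · have hbd : ∀ z, ENNReal.ofReal (‖F z‖ * Real.exp (-φ z)) ≤
        ((∫⁻ z, g z ∂vol n) / K) ^ q⁻¹ := fun z => by
      rw [ENNReal.le_rpow_inv_iff hq0, hpow, ENNReal.le_div_iff_mul_le (.inl hK0) (.inl hKt)]
      exact (hmean z).trans (setLIntegral_le_lintegral _ _)
    have hk := hkey F hF _
      (ENNReal.rpow_lt_top_of_nonneg (inv_nonneg.2 hq0.le) (ENNReal.div_lt_top hfin.ne hK0).ne) hbd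
    have hptw : ∀ w, g w ≤ ENNReal.ofReal M ^ q *
        ∑' σ : S, g σ * ENNReal.ofReal (Real.exp (-(q * ε * ‖w - σ‖ ^ 2))) := fun w => by
      rw [← hpow w]
      refine (ENNReal.rpow_le_rpow (hk w) hq0.le).trans ?_
      rw [ENNReal.mul_rpow_of_nonneg _ _ hq0.le]
      gcongr
      rw [← ENNReal.le_rpow_inv_iff hq0]
      refine iSup₂_le fun σ hσ => ?_
      rw [ENNReal.le_rpow_inv_iff hq0, ENNReal.ofReal_mul (by positivity),
        ENNReal.mul_rpow_of_nonneg _ _ hq0.le, hpow,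
        ENNReal.ofReal_rpow_of_nonneg (by positivity) hq0.le, ← Real.exp_mul]
      refine le_trans (le_of_eq ?_) (ENNReal.le_tsum (⟨σ, hσ⟩ : S))
      ring_nf
    have hmg : ∀ σ : En n, Measurable fun w : En n =>
        ENNReal.ofReal (Real.exp (-(q * ε * ‖w - σ‖ ^ 2))) := fun σ => by
      have : Continuous fun w : En n => Real.exp (-(q * ε * ‖w - σ‖ ^ 2)) := by fun_prop
      exact this.measurable.ennreal_ofReal
    calc ∫⁻ z, g z ∂vol n
        ≤ ∫⁻ w, ENNReal.ofReal M ^ q *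
          ∑' σ : S, g σ * ENNReal.ofReal (Real.exp (-(q * ε * ‖w - σ‖ ^ 2))) ∂vol n :=
          lintegral_mono hptw
      _ = ENNReal.ofReal M ^ q * ∑' σ : S, g σ * D := by
          rw [lintegral_const_mul' _ _ (ENNReal.rpow_ne_top_of_nonneg hq0.le ENNReal.ofReal_ne_top),
            lintegral_tsum fun σ : S => ((hmg σ).const_mul _).aemeasurable]
          congr 2 with σ
          rw [lintegral_const_mul _ (hmg σ), lintegral_sub_right_eq_self (fun x : En n =>
            ENNReal.ofReal (Real.exp (-(q * ε * ‖x‖ ^ 2)))) (σ : En n)]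
      _ = ENNReal.ofReal M ^ q * D * ∑' σ : S, g σ := by
          rw [ENNReal.tsum_mul_right]; ring
      _ ≤ _ := by gcongr; exact le_self_add
  · intro _
    have hsum : (∑' σ : S, g σ) * K ≤ ∫⁻ z, g z ∂vol n := by
      rw [← ENNReal.tsum_mul_right]
      refine (ENNReal.tsum_le_tsum fun σ : S => hmean σ).trans ?_
      rw [← lintegral_iUnion (fun _ => measurableSet_ball) hdisj]
      exact setLIntegral_le_lintegral _ _
    calc ∑' σ : S, g σ ≤ (∫⁻ z, g z ∂vol n) / K :=
          (ENNReal.le_div_iff_mul_le (.inl hK0) (.inl hKt)).2 hsum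
      _ = K⁻¹ * ∫⁻ z, g z ∂vol n := by rw [div_eq_mul_inv, mul_comm]
      _ ≤ _ := by gcongr; exact le_add_self
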